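/- Let φ : R → S be a faithfully flat homomorphism of commutative rings, C_R a class of R-modules, and C_S a class of S-modules such that Def(C_S^⊺) = Def((C_R ⊗_R S)^⊺). If M is an R-module such that M ⊗_R S is a flat Def(C_S^⊺)-Mittag-Leffler S-module, then M is a flat Def(C_R^⊺)-Mittag-Leffler R-module. -/

import Mathlib

open TensorProduct CategoryTheory

universe u

noncomputable section

/-- A module `M` over a commutative ring `A` is *Mittag-Leffler relative to a class `𝒬`*
of `A`-modules if for every family `(Nᵢ)` of modules from `𝒬` the canonical map
`M ⊗[A] ∏ᵢ Nᵢ → ∏ᵢ (M ⊗[A] Nᵢ)` is injective. -/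
def IsRelMittagLeffler (A : Type u) [CommRing A] (M : Type u) [AddCommGroup M] [Module A M]
    (𝒬 : (N : Type u) → [AddCommGroup N] → [Module A N] → Prop) : Prop :=
  ∀ (I : Type u) (N : I → Type u) [∀ i, AddCommGroup (N i)] [∀ i, Module A (N i)],
    (∀ i, 𝒬 (N i)) → Function.Injective (TensorProduct.piRightHom A A M N)

/-- Given a ring map `R → S` (encoded as an `Algebra R S`) and a class `𝒬` of `R`-modules,
`BaseChangeClass R S 𝒬` is the class of `S`-modules of the form `Q ⊗[R] S` (`= S ⊗[R] Q`)
with `Q ∈ 𝒬`. -/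
def BaseChangeClass (R S : Type u) [CommRing R] [CommRing S] [Algebra R S]
    (𝒬 : (N : Type u) → [AddCommGroup N] → [Module R N] → Prop) :
    (N : Type u) → [AddCommGroup N] → [Module S N] → Prop :=
  fun N' _ _ => ∃ (Q : Type u) (_ : AddCommGroup Q) (_ : Module R Q),
    𝒬 Q ∧ Nonempty (N' ≃ₗ[S] S ⊗[R] Q)

/-- An `A`-linear map is a pure monomorphism if it stays injective after tensoring with any
`A`-module. -/
def IsPureMono {A : Type u} [CommRing A] {M N : Type u} [AddCommGroup M] [Module A M]
    [AddCommGroup N] [Module A N] (f : M →ₗ[A] N) : Prop :=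
  ∀ (P : Type u) [AddCommGroup P] [Module A P], Function.Injective (LinearMap.rTensor P f)

/-- A class of `A`-modules is definable if it is closed under isomorphisms, direct products,
direct limits and pure submodules. -/
structure IsDefinableClass (A : Type u) [CommRing A]
    (𝒞 : (N : Type u) → [AddCommGroup N] → [Module A N] → Prop) : Prop where
  closed_iso : ∀ (N₁ : Type u) [AddCommGroup N₁] [Module A N₁]
    (N₂ : Type u) [AddCommGroup N₂] [Module A N₂],
    Nonempty (N₁ ≃ₗ[A] N₂) → 𝒞 N₁ → 𝒞 N₂
  closed_prod : ∀ (I : Type u) (N : I → Type u) [∀ i, AddCommGroup (N i)]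
    [∀ i, Module A (N i)], (∀ i, 𝒞 (N i)) → 𝒞 (∀ i, N i)
  closed_directLimit : ∀ (ι : Type u) [Preorder ι] [IsDirected ι (· ≤ ·)] [DecidableEq ι]
    (G : ι → Type u) [∀ i, AddCommGroup (G i)] [∀ i, Module A (G i)]
    (f : ∀ i j, i ≤ j → G i →ₗ[A] G j), DirectedSystem G (fun i j h => f i j h) →
    (∀ i, 𝒞 (G i)) → 𝒞 (Module.DirectLimit G f)
  closed_pureSubmodule : ∀ (N : Type u) [AddCommGroup N] [Module A N] (p : Submodule A N),
    IsPureMono p.subtype → 𝒞 N → 𝒞 p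

/-- The definable closure `Def(𝒬)` of a class of `A`-modules: the least definable class
containing `𝒬`. -/
def DefClosure (A : Type u) [CommRing A]
    (𝒬 : (N : Type u) → [AddCommGroup N] → [Module A N] → Prop) :
    (N : Type u) → [AddCommGroup N] → [Module A N] → Prop :=
  fun N _ _ => ∀ (𝒞 : (N : Type u) → [AddCommGroup N] → [Module A N] → Prop),
    IsDefinableClass A 𝒞 →
    (∀ (Q : Type u) [AddCommGroup Q] [Module A Q], 𝒬 Q → 𝒞 Q) → 𝒞 N

/-- `Tor₁^A(N, M) = 0`. -/
def Tor1Vanishes (A : Type u) [CommRing A] (N M : Type u) [AddCommGroup N] [Module A N]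
    [AddCommGroup M] [Module A M] : Prop :=
  Subsingleton (((Tor (ModuleCat.{u} A) 1).obj (ModuleCat.of A N)).obj (ModuleCat.of A M))

/-- The class `𝒞^⊺` of all `A`-modules `D` with `Tor₁^A(C, D) = 0` for all `C ∈ 𝒞`. -/
def TorPerp (A : Type u) [CommRing A]
    (𝒞 : (N : Type u) → [AddCommGroup N] → [Module A N] → Prop) :
    (N : Type u) → [AddCommGroup N] → [Module A N] → Prop :=
  fun D _ _ => ∀ (C : Type u) [AddCommGroup C] [Module A C], 𝒞 C → Tor1Vanishes A C D

/-- `Ext¹_A(M, B) = 0`. -/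
def Ext1Vanishes (A : Type u) [CommRing A] (M B : Type u) [AddCommGroup M] [Module A M]
    [AddCommGroup B] [Module A B] : Prop :=
  Subsingleton
    (((Ext A (ModuleCat.{u} A) 1).obj (Opposite.op (ModuleCat.of A M))).obj (ModuleCat.of A B))

/-- The dual definable class `𝒬^∨`: the least definable class containing the character modules
`Q⁺ = Hom_ℤ(Q, ℚ/ℤ)` of all `Q ∈ 𝒬`. -/
def DualDefClass (A : Type u) [CommRing A]
    (𝒬 : (N : Type u) → [AddCommGroup N] → [Module A N] → Prop) :
    (N : Type u) → [AddCommGroup N] → [Module A N] → Prop :=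
  DefClosure A (fun N _ _ => ∃ (Q : Type u) (_ : AddCommGroup Q) (_ : Module A Q),
    𝒬 Q ∧ Nonempty (N ≃ₗ[A] CharacterModule Q))

/-- A module `M` is countably presented if it admits a presentation with countably many
generators and countably many relations. -/
def CountablyPresented (A : Type u) [CommRing A] (M : Type u) [AddCommGroup M]
    [Module A M] : Prop :=
  ∃ (g : (ℕ →₀ A) →ₗ[A] M), Function.Surjective g ∧
    ∃ s : Set (ℕ →₀ A), s.Countable ∧ Submodule.span A s = LinearMap.ker g

/-- A module `M` is f-projective if it is flat and Mittag-Leffler relative to `{A}`. -/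
def IsFProjective (A : Type u) [CommRing A] (M : Type u) [AddCommGroup M] [Module A M] : Prop :=
  Module.Flat A M ∧
    IsRelMittagLeffler A M (fun N _ _ => Nonempty (N ≃ₗ[A] A))

/-- `M` is an FP₂ module: there is an exact sequence `F₂ → F₁ → F₀ → M → 0` with the `Fᵢ`
finitely generated free (equivalently, `M` has a projective resolution whose first three
terms are finitely generated). -/
def IsFP2 (A : Type u) [CommRing A] (M : Type u) [AddCommGroup M] [Module A M] : Prop :=
  ∃ (n₀ n₁ n₂ : ℕ) (f₀ : (Fin n₀ → A) →ₗ[A] M) (f₁ : (Fin n₁ → A) →ₗ[A] (Fin n₀ → A))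
    (f₂ : (Fin n₂ → A) →ₗ[A] (Fin n₁ → A)),
    Function.Surjective f₀ ∧ LinearMap.range f₁ = LinearMap.ker f₀ ∧
      LinearMap.range f₂ = LinearMap.ker f₁

/-- `M` has flat (weak) dimension at most `n`: there is a flat resolution
`0 → F_n → ⋯ → F_0 → M → 0` (formalized as a resolution `F` with `F k = 0` for `k > n`). -/
def FlatDimLE (A : Type u) [CommRing A] (M : Type u) [AddCommGroup M] [Module A M]
    (n : ℕ) : Prop :=
  ∃ (F : ℕ → Type u) (_ : ∀ k, AddCommGroup (F k)) (_ : ∀ k, Module A (F k))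
    (d : ∀ k, F (k + 1) →ₗ[A] F k) (ε : F 0 →ₗ[A] M),
    (∀ k, Module.Flat A (F k)) ∧ (∀ k, n < k → Subsingleton (F k)) ∧
    Function.Surjective ε ∧ LinearMap.ker ε = LinearMap.range (d 0) ∧
    ∀ k, LinearMap.ker (d k) = LinearMap.range (d (k + 1))

/-- `M` has injective dimension at most `n`: there is an injective coresolution
`0 → M → I_0 → ⋯ → I_n → 0` (formalized as a coresolution `I` with `I k = 0` for `k > n`). -/
def InjDimLE (A : Type u) [CommRing A] (M : Type u) [AddCommGroup M] [Module A M]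
    (n : ℕ) : Prop :=
  ∃ (I : ℕ → Type u) (_ : ∀ k, AddCommGroup (I k)) (_ : ∀ k, Module A (I k))
    (d : ∀ k, I k →ₗ[A] I (k + 1)) (ε : M →ₗ[A] I 0),
    (∀ k, Module.Injective A (I k)) ∧ (∀ k, n < k → Subsingleton (I k)) ∧
    Function.Injective ε ∧ LinearMap.range ε = LinearMap.ker (d 0) ∧
    ∀ k, LinearMap.range (d k) = LinearMap.ker (d (k + 1))

/-- `B` is pure-injective: every pure monomorphism `X → Y` induces a surjection
`Hom(Y, B) → Hom(X, B)`. -/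
def IsPureInjective (A : Type u) [CommRing A] (B : Type u) [AddCommGroup B]
    [Module A B] : Prop :=
  ∀ (X Y : Type u) [AddCommGroup X] [Module A X] [AddCommGroup Y] [Module A Y]
    (f : X →ₗ[A] Y), IsPureMono f → ∀ g : X →ₗ[A] B, ∃ h : Y →ₗ[A] B, h ∘ₗ f = g

lemma lTensor_exact_iff_injective_lTensor_range {A N X₂ X₁ X₀ : Type*} [CommRing A]
    [AddCommGroup N] [Module A N] [AddCommGroup X₂] [Module A X₂] [AddCommGroup X₁] [Module A X₁]
    [AddCommGroup X₀] [Module A X₀] {f : X₂ →ₗ[A] X₁} {g : X₁ →ₗ[A] X₀}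
    (hfg : Function.Exact f g) :
    Function.Exact (f.lTensor N) (g.lTensor N) ↔
      Function.Injective ((LinearMap.range g).subtype.lTensor N) := by
  have hfg' : Function.Exact f g.rangeRestrict := fun x ↦ by
    rw [← hfg x, ← Subtype.val_inj]; rfl
  have hex := lTensor_exact N hfg' g.surjective_rangeRestrict
  have hsurj := LinearMap.lTensor_surjective N g.surjective_rangeRestrict
  have hg (x : N ⊗[A] X₁) : g.lTensor N x =
      (LinearMap.range g).subtype.lTensor N (g.rangeRestrict.lTensor N x) := by
    rw [← LinearMap.comp_apply, ← LinearMap.lTensor_comp]; rfl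
  constructor
  · intro h
    rw [injective_iff_map_eq_zero]
    intro y hy
    obtain ⟨x, rfl⟩ := hsurj y
    rw [← hg] at hy
    exact (hex x).2 ((h x).1 hy)
  · intro h x
    rw [hg, map_eq_zero_iff _ h]
    exact hex x

lemma exists_projective_tor1Vanishes_iff (A : Type u) [CommRing A] (M : Type u)
    [AddCommGroup M] [Module A M] :
    ∃ (P : Type u) (_ : AddCommGroup P) (_ : Module A P) (π : P →ₗ[A] M),
      Module.Projective A P ∧ Function.Surjective π ∧
      ∀ (N : Type u) [AddCommGroup N] [Module A N], Tor1Vanishes A N M ↔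
        Function.Injective ((LinearMap.ker π).subtype.lTensor N) := by
  obtain ⟨P⟩ := (inferInstance : HasProjectiveResolution (ModuleCat.of A M)).out
  have hex0 := P.exact₀
  have hex1 := P.exact_succ 0
  rw [ShortComplex.ShortExact.moduleCat_exact_iff_function_exact] at hex0 hex1
  let π : P.complex.X 0 →ₗ[A] M := (P.π.f 0).hom
  have hker : LinearMap.ker π = LinearMap.range (P.complex.d 1 0).hom := hex0.linearMap_ker_eq
  refine ⟨P.complex.X 0, inferInstance, inferInstance, π, ?_, ?_, ?_⟩
  · exact (IsProjective.iff_projective _).2 (P.projective 0)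
  · exact (ModuleCat.epi_iff_surjective _).1 inferInstance
  · intro N _ _
    let F := (MonoidalCategory.tensoringLeft (ModuleCat A)).obj (ModuleCat.of A N)
    have hTor : Tor1Vanishes A N M ↔
        ((F.mapHomologicalComplex _).obj P.complex).ExactAt 1 := by
      rw [HomologicalComplex.exactAt_iff_isZero_homology, ModuleCat.isZero_iff_subsingleton]
      exact (forget (ModuleCat A)).mapIso (P.isoLeftDerivedObj F 1) |>.toEquiv.subsingleton_congr
    rw [hTor, HomologicalComplex.exactAt_iff' _ 2 1 0 (by simp) (by simp),
      ShortComplex.ShortExact.moduleCat_exact_iff_function_exact, hker]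
    exact lTensor_exact_iff_injective_lTensor_range hex1

lemma injective_lTensor_ker_of_projective {A N M P P' : Type*} [CommRing A]
    [AddCommGroup N] [Module A N] [AddCommGroup M] [Module A M] [AddCommGroup P] [Module A P]
    [AddCommGroup P'] [Module A P'] [Module.Projective A P] [Module.Projective A P']
    {π : P →ₗ[A] M} {π' : P' →ₗ[A] M} (hπ : Function.Surjective π) (hπ' : Function.Surjective π')
    (h : Function.Injective ((LinearMap.ker π).subtype.lTensor N)) :
    Function.Injective ((LinearMap.ker π').subtype.lTensor N) := by
  obtain ⟨a, ha⟩ := Module.projective_lifting_property π π' hπ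
  obtain ⟨b, hb⟩ := Module.projective_lifting_property π' π hπ'
  have ha' (x) : π (a x) = π' x := LinearMap.congr_fun ha x
  have hb' (x) : π' (b x) = π x := LinearMap.congr_fun hb x
  let a₀ : LinearMap.ker π' →ₗ[A] LinearMap.ker π := a.restrict fun x hx ↦ by
    simpa [ha'] using hx
  let b₀ : LinearMap.ker π →ₗ[A] LinearMap.ker π' := b.restrict fun x hx ↦ by
    simpa [hb'] using hx
  let s : P' →ₗ[A] LinearMap.ker π' := (LinearMap.id - b ∘ₗ a).codRestrict _ fun x ↦ by
    simp [ha', hb']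
  have hid : LinearMap.id = s ∘ₗ (LinearMap.ker π').subtype + b₀ ∘ₗ a₀ := by
    ext x; simp [s, a₀, b₀]
  have hcomm : (LinearMap.ker π).subtype ∘ₗ a₀ = a ∘ₗ (LinearMap.ker π').subtype := by
    ext x; simp [a₀]
  rw [injective_iff_map_eq_zero]
  intro x hx
  have hx' : a₀.lTensor N x = 0 := by
    apply h
    rw [← LinearMap.comp_apply, ← LinearMap.lTensor_comp, hcomm, LinearMap.lTensor_comp,
      LinearMap.comp_apply, hx, map_zero, map_zero]
  have := LinearMap.congr_fun (congrArg (LinearMap.lTensor N) hid) x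
  simpa [LinearMap.lTensor_add, LinearMap.lTensor_comp, hx, hx'] using this

lemma tor1Vanishes_iff_of_projective {A M P N : Type u} [CommRing A]
    [AddCommGroup N] [Module A N] [AddCommGroup M] [Module A M] [AddCommGroup P] [Module A P]
    [Module.Projective A P] {π : P →ₗ[A] M} (hπ : Function.Surjective π) :
    Tor1Vanishes A N M ↔ Function.Injective ((LinearMap.ker π).subtype.lTensor N) := by
  obtain ⟨P', _, _, π', _, hπ', h⟩ := exists_projective_tor1Vanishes_iff A M
  rw [h]
  exact ⟨injective_lTensor_ker_of_projective hπ' hπ, injective_lTensor_ker_of_projective hπ hπ'⟩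

lemma injective_lTensor_range_iff {A N K P : Type*} [CommRing A]
    [AddCommGroup N] [Module A N] [AddCommGroup K] [Module A K] [AddCommGroup P] [Module A P]
    {f : K →ₗ[A] P} (hf : Function.Injective f) :
    Function.Injective ((LinearMap.range f).subtype.lTensor N) ↔
      Function.Injective (f.lTensor N) := by
  have : f.lTensor N = (LinearMap.range f).subtype.lTensor N ∘
      LinearEquiv.lTensor N (LinearEquiv.ofInjective f hf) := by
    rw [← LinearEquiv.coe_coe, LinearEquiv.coe_lTensor, ← LinearMap.coe_comp,
      ← LinearMap.lTensor_comp]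
    rfl
  rw [this, EquivLike.injective_comp]

/-- Vanishing of `Tor₁` is preserved by flat base change. -/
lemma Tor1Vanishes.baseChange {R S : Type u} [CommRing R] [CommRing S] [Algebra R S]
    [Module.Flat R S] {C D C' : Type u} [AddCommGroup C] [Module R C] [AddCommGroup D] [Module R D]
    [AddCommGroup C'] [Module S C'] (e : C' ≃ₗ[S] S ⊗[R] C) (h : Tor1Vanishes R C D) :
    Tor1Vanishes S C' (S ⊗[R] D) := by
  obtain ⟨P, _, _, π, _, hπ, hTor⟩ := exists_projective_tor1Vanishes_iff R D
  rw [hTor] at h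
  have hex : Function.Exact ((LinearMap.ker π).subtype.baseChange S) (π.baseChange S) :=
    lTensor_exact S π.exact_subtype_ker_map hπ
  have hinj : Function.Injective ((LinearMap.ker π).subtype.baseChange S) :=
    Module.Flat.lTensor_preserves_injective_linearMap _ (Submodule.subtype_injective _)
  rw [tor1Vanishes_iff_of_projective (π := π.baseChange S) (LinearMap.lTensor_surjective S hπ),
    hex.linearMap_ker_eq, injective_lTensor_range_iff hinj]
  let ψ (Q : Type u) [AddCommGroup Q] [Module R Q] :
      C' ⊗[S] (S ⊗[R] Q) ≃ₗ[S] S ⊗[R] (C ⊗[R] Q) :=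
    (TensorProduct.congr e (.refl S _)).trans
      (AlgebraTensorModule.distribBaseChange R S C Q).symm
  have hψ (z : C' ⊗[S] (S ⊗[R] LinearMap.ker π)) :
      ψ P (((LinearMap.ker π).subtype.baseChange S).lTensor C' z) =
        ((LinearMap.ker π).subtype.lTensor C).baseChange S (ψ (LinearMap.ker π) z) := by
    induction z with
    | zero => simp
    | add x y hx hy => simp only [map_add, hx, hy]
    | tmul c y =>
      induction y with
      | zero => simp
      | add x y hx hy => simp only [tmul_add, map_add, hx, hy]
      | tmul s k =>
        obtain ⟨w, rfl⟩ := e.symm.surjective c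
        induction w with
        | zero => simp
        | add x y hx hy => simp only [add_tmul, map_add, hx, hy]
        | tmul t c => simp [ψ, AlgebraTensorModule.distribBaseChange, smul_tmul']
  have hinj' : Function.Injective (((LinearMap.ker π).subtype.lTensor C).baseChange S) :=
    Module.Flat.lTensor_preserves_injective_linearMap _ h
  intro x y hxy
  apply (ψ (LinearMap.ker π)).injective
  apply hinj'
  rw [← hψ, ← hψ, hxy]

lemma isDefinableClass_defClosure (A : Type u) [CommRing A]
    (𝒬 : (N : Type u) → [AddCommGroup N] → [Module A N] → Prop) :
    IsDefinableClass A (DefClosure A 𝒬) where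
  closed_iso N₁ _ _ N₂ _ _ e h 𝒞 h𝒞 hQ := h𝒞.closed_iso N₁ N₂ e (h 𝒞 h𝒞 hQ)
  closed_prod I N _ _ h 𝒞 h𝒞 hQ := h𝒞.closed_prod I N fun i ↦ h i 𝒞 h𝒞 hQ
  closed_directLimit ι _ _ _ G _ _ f hf h 𝒞 h𝒞 hQ :=
    h𝒞.closed_directLimit ι G f hf fun i ↦ h i 𝒞 h𝒞 hQ
  closed_pureSubmodule N _ _ p hp h 𝒞 h𝒞 hQ := h𝒞.closed_pureSubmodule N p hp (h 𝒞 h𝒞 hQ)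

/-- The class of `R`-modules admitting an injective map, semilinear along `R → S`, into a member
of a class of `S`-modules. -/
def RestrictionSubobjects (R S : Type u) [CommRing R] [CommRing S] [Algebra R S]
    (𝒟 : (N : Type u) → [AddCommGroup N] → [Module S N] → Prop) :
    (N : Type u) → [AddCommGroup N] → [Module R N] → Prop :=
  fun N _ _ => ∃ (X : Type u) (_ : AddCommGroup X) (_ : Module S X)
    (e : N →ₛₗ[algebraMap R S] X), 𝒟 X ∧ Function.Injective e

lemma IsDefinableClass.restrictionSubobjects {R S : Type u} [CommRing R] [CommRing S]
    [Algebra R S] {𝒟 : (N : Type u) → [AddCommGroup N] → [Module S N] → Prop}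
    (h𝒟 : IsDefinableClass S 𝒟) : IsDefinableClass R (RestrictionSubobjects R S 𝒟) where
  closed_iso := by
    rintro N₁ _ _ N₂ _ _ ⟨ε⟩ ⟨X, _, _, e, hX, he⟩
    exact ⟨X, _, _, e.comp ε.symm.toLinearMap, hX, he.comp ε.symm.injective⟩
  closed_prod := by
    intro I N _ _ h
    choose X _ _ e hX he using h
    exact ⟨∀ i, X i, inferInstance, inferInstance,
      { toFun x i := e i (x i)
        map_add' _ _ := by ext; simp
        map_smul' _ _ := by ext; simp },
      h𝒟.closed_prod I X hX, fun x y hxy ↦ funext fun i ↦ he i (congrFun hxy i)⟩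
  closed_pureSubmodule := by
    rintro N _ _ p - ⟨X, _, _, e, hX, he⟩
    exact ⟨X, _, _, e.comp p.subtype, hX, he.comp p.subtype_injective⟩
  closed_directLimit := by
    intro ι _ _ _ G _ _ f hf h
    choose X _ _ e hX he using h
    let Y (k : ι) := ∀ j : {j // k ≤ j}, X j
    let g (k l : ι) (hkl : k ≤ l) : Y k →ₗ[S] Y l :=
      LinearMap.pi fun j ↦ LinearMap.proj (⟨j, hkl.trans j.2⟩ : {j // k ≤ j})
    have hg : DirectedSystem Y (fun k l hkl ↦ g k l hkl) := ⟨fun _ _ ↦ rfl, fun _ _ _ _ _ _ ↦ rfl⟩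
    let ε (k : ι) : G k →ₛₗ[algebraMap R S] Y k :=
      { toFun x j := e j (f k j j.2 x)
        map_add' _ _ := by ext; simp [Y]
        map_smul' _ _ := by ext; simp [Y] }
    have hε (k : ι) : Function.Injective (ε k) := fun x y hxy ↦ he k <| by
      simpa [ε, hf.map_self] using congrFun hxy ⟨k, le_rfl⟩
    let _ : Module R (Module.DirectLimit Y g) := Module.compHom _ (algebraMap R S)
    let η (k : ι) : G k →ₗ[R] Module.DirectLimit Y g :=
      { toFun x := Module.DirectLimit.of S ι Y g k (ε k x)
        map_add' _ _ := by simp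
        map_smul' r x := by rw [map_smulₛₗ, map_smul]; rfl }
    have hη (k l : ι) (hkl : k ≤ l) (x : G k) : η l (f k l hkl x) = η k x := by
      change Module.DirectLimit.of S ι Y g l _ = Module.DirectLimit.of S ι Y g k _
      rw [← Module.DirectLimit.of_f (hij := hkl)]
      congr 1
      ext j
      exact congrArg (e j) (hf.map_map hkl j.2 x)
    let L := Module.DirectLimit.lift R ι G f η hη
    have hL (z : Module.DirectLimit G f) (hz : L z = 0) : z = 0 := by
      cases isEmpty_or_nonempty ι
      · exact Subsingleton.elim _ _
      obtain ⟨k, x, rfl⟩ := Module.DirectLimit.exists_of z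
      rw [Module.DirectLimit.lift_of] at hz
      obtain ⟨l, hkl, hl⟩ := Module.DirectLimit.of.zero_exact hz
      rw [← Module.DirectLimit.of_f (hij := hkl), hε l (a₁ := f k l hkl x) (a₂ := 0), map_zero]
      rw [map_zero, ← hl]
      ext j
      exact congrArg (e j) (hf.map_map hkl j.2 x)
    exact ⟨Module.DirectLimit Y g, inferInstance, inferInstance,
      { toFun := L, map_add' := map_add L, map_smul' := fun r x ↦ map_smul L r x },
      h𝒟.closed_directLimit ι Y g hg fun k ↦ h𝒟.closed_prod _ _ fun j ↦ hX j,
      (injective_iff_map_eq_zero L).2 hL⟩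

lemma isRelMittagLeffler_of_baseChange {R S : Type u} [CommRing R] [CommRing S] [Algebra R S]
    {𝒟 : (N : Type u) → [AddCommGroup N] → [Module S N] → Prop}
    {M : Type u} [AddCommGroup M] [Module R M] [Module.Flat R M]
    (h : IsRelMittagLeffler S (S ⊗[R] M) 𝒟) :
    IsRelMittagLeffler R M (RestrictionSubobjects R S 𝒟) := by
  intro I N _ _ hN
  choose X _ _ e hX he using hN
  let _ (i) : Module R (X i) := Module.compHom _ (algebraMap R S)
  have (i : I) : IsScalarTower R S (X i) := .of_algebraMap_smul fun _ _ ↦ rfl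
  let e' (i) : N i →ₗ[R] X i := { toFun := e i, map_add' := map_add (e i), map_smul' := map_smulₛₗ (e i) }
  let E : (∀ i, N i) →ₗ[R] ∀ i, X i := LinearMap.pi fun i ↦ e' i ∘ₗ LinearMap.proj i
  have hE : Function.Injective E := fun x y hxy ↦ funext fun i ↦ he i (congrFun hxy i)
  let ψ (Y : Type u) [AddCommGroup Y] [Module R Y] [Module S Y] [IsScalarTower R S Y] :
      M ⊗[R] Y ≃ₗ[R] (S ⊗[R] M) ⊗[S] Y :=
    TensorProduct.comm R M Y ≪≫ₗ
      ((AlgebraTensorModule.cancelBaseChange R S S Y M).symm ≪≫ₗ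
        TensorProduct.comm S Y (S ⊗[R] M)).restrictScalars R
  have hψ (z : M ⊗[R] (∀ i, N i)) (i : I) :
      piRightHom S S (S ⊗[R] M) X (ψ _ (E.lTensor M z)) i =
        ψ _ ((e' i).lTensor M (piRightHom R R M N z i)) := by
    induction z with
    | zero => simp
    | add x y hx hy => simp only [map_add, Pi.add_apply, hx, hy]
    | tmul m n => simp [ψ, E]
  rw [injective_iff_map_eq_zero]
  intro z hz
  apply Module.Flat.lTensor_preserves_injective_linearMap (M := M) E hE
  apply (ψ _).injective
  apply h I X hX
  ext i
  rw [hψ, hz]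
  simp

/-- Let `φ : R → S` be faithfully flat, `𝒞_R` a class of `R`-modules and
`𝒞_S` a class of `S`-modules with `Def(𝒞_S^⊺) = Def((𝒞_R ⊗[R] S)^⊺)`. If `M ⊗[R] S` is a
flat `Def(𝒞_S^⊺)`-Mittag-Leffler `S`-module, then `M` is a flat `Def(𝒞_R^⊺)`-Mittag-Leffler
`R`-module. -/
theorem stmt_11 (R S : Type u) [CommRing R] [CommRing S] [Algebra R S] [Module.FaithfullyFlat R S]
    (𝒞R : (N : Type u) → [AddCommGroup N] → [Module R N] → Prop)
    (𝒞S : (N : Type u) → [AddCommGroup N] → [Module S N] → Prop)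
    (hC2 : DefClosure S (TorPerp S 𝒞S) = DefClosure S (TorPerp S (BaseChangeClass R S 𝒞R)))
    (M : Type u) [AddCommGroup M] [Module R M]
    (hflat : Module.Flat S (S ⊗[R] M))
    (hml : IsRelMittagLeffler S (S ⊗[R] M) (DefClosure S (TorPerp S 𝒞S))) :
    Module.Flat R M ∧
      IsRelMittagLeffler R M (DefClosure R (TorPerp R 𝒞R)) := by
  have hM : Module.Flat R M := .of_flat_tensorProduct R M S
  rw [hC2] at hml
  refine ⟨hM, fun I N _ _ hN ↦ isRelMittagLeffler_of_baseChange hml I N fun i ↦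
    hN i _ (isDefinableClass_defClosure S _).restrictionSubobjects ?_⟩
  intro D _ _ hD
  refine ⟨S ⊗[R] D, inferInstance, inferInstance,
    { toFun := TensorProduct.mk R S D 1
      map_add' := map_add _
      map_smul' r x := by simp },
    fun 𝒞 _ h𝒞 ↦ h𝒞 _ ?_, Module.FaithfullyFlat.tensorProduct_mk_injective D⟩
  rintro C' _ _ ⟨C, _, _, hC, ⟨ε⟩⟩
  exact (hD C hC).baseChange ε

end
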